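/- Let (B,·,∘) be a skew left brace and (B,λ,ρ) its associated solution. Then (B,λ,ρ) is 2-reductive (λ_{λ_x(y)}=λ_y, ρ_{ρ_x(y)}=ρ_y, λ_{ρ_x(y)}=λ_y and ρ_{λ_x(y)}=ρ_y for all x,y ∈ B) if and only if λ_{a·b} = λ_{b·a} = λ_{a∘b} and ρ_{a·b} = ρ_{b·a} = ρ_{a∘b} for all a,b ∈ B. -/

import Mathlib

/-- A skew left brace: two group operations `·` (mul) and `∘` (circ) on `B`
sharing the neutral element `1`, satisfying
`a ∘ (b · c) = (a ∘ b) · a⁻¹ · (a ∘ c)`. -/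
structure SkewLeftBrace (B : Type*) where
  mul : B → B → B
  one : B
  inv : B → B
  circ : B → B → B
  oinv : B → B
  mul_assoc : ∀ a b c, mul (mul a b) c = mul a (mul b c)
  one_mul : ∀ a, mul one a = a
  mul_one : ∀ a, mul a one = a
  inv_mul : ∀ a, mul (inv a) a = one
  mul_inv : ∀ a, mul a (inv a) = one
  circ_assoc : ∀ a b c, circ (circ a b) c = circ a (circ b c)
  one_circ : ∀ a, circ one a = a
  circ_one : ∀ a, circ a one = a
  oinv_circ : ∀ a, circ (oinv a) a = one
  circ_oinv : ∀ a, circ a (oinv a) = one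
  compat : ∀ a b c, circ a (mul b c) = mul (mul (circ a b) (inv a)) (circ a c)

namespace SkewLeftBrace

variable {B : Type*}

/-- `λ_a(b) = a⁻¹ · (a ∘ b)`. -/
def lam (S : SkewLeftBrace B) (a b : B) : B := S.mul (S.inv a) (S.circ a b)

/-- `ρ_b(a) = (λ_a(b))‾ ∘ a ∘ b`, so that `(B, lam, rho)` is the solution
associated to the skew left brace. -/
def rho (S : SkewLeftBrace B) (b a : B) : B :=
  S.circ (S.circ (S.oinv (S.lam a b)) a) b

/-- `(B, ·, ∘)` is a bi-skew left brace: `(B, ∘, ·)` is also a skew left brace,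
i.e. `a · (b ∘ c) = (a · b) ∘ ā ∘ (a · c)`. -/
def IsBiSkew (S : SkewLeftBrace B) : Prop :=
  ∀ a b c, S.mul a (S.circ b c) =
    S.circ (S.circ (S.mul a b) (S.oinv a)) (S.mul a c)


variable {B : Type*}

theorem mul_left_cancel (S : SkewLeftBrace B) {a b c : B} (h : S.mul a b = S.mul a c) : b = c := by
  rw [← S.one_mul b, ← S.one_mul c, ← S.inv_mul a, S.mul_assoc, S.mul_assoc, h]

theorem circ_left_cancel (S : SkewLeftBrace B) {a b c : B} (h : S.circ a b = S.circ a c) :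
    b = c := by
  rw [← S.one_circ b, ← S.one_circ c, ← S.oinv_circ a, S.circ_assoc, S.circ_assoc, h]

theorem mul_lam (S : SkewLeftBrace B) (a b : B) : S.mul a (S.lam a b) = S.circ a b := by
  rw [lam, ← S.mul_assoc, S.mul_inv, S.one_mul]

theorem lam_mul (S : SkewLeftBrace B) (a b c : B) :
    S.lam a (S.mul b c) = S.mul (S.lam a b) (S.lam a c) := by
  simp only [lam, S.compat, S.mul_assoc]

theorem lam_circ (S : SkewLeftBrace B) (a b c : B) :
    S.lam (S.circ a b) c = S.lam a (S.lam b c) := by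
  apply S.mul_left_cancel (a := S.circ a b)
  rw [mul_lam, ← S.mul_lam a b, S.mul_assoc, ← lam_mul, mul_lam, mul_lam, mul_lam,
    S.circ_assoc]

theorem lam_one (S : SkewLeftBrace B) (a : B) : S.lam S.one a = a := by
  rw [← S.one_mul (S.lam S.one a), mul_lam, S.one_circ]

theorem lam_lam_oinv (S : SkewLeftBrace B) (a b : B) : S.lam a (S.lam (S.oinv a) b) = b := by
  rw [← lam_circ, S.circ_oinv, lam_one]

theorem circ_lam_oinv (S : SkewLeftBrace B) (a b : B) :
    S.circ a (S.lam (S.oinv a) b) = S.mul a b := by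
  rw [← mul_lam, lam_lam_oinv]

theorem lam_circ_rho (S : SkewLeftBrace B) (a b : B) :
    S.circ (S.lam a b) (S.rho b a) = S.circ a b := by
  rw [rho, S.circ_assoc, ← S.circ_assoc, S.circ_oinv, S.one_circ]

theorem lam_circ_right (S : SkewLeftBrace B) (a b c : B) :
    S.lam a (S.circ b c) = S.circ (S.lam a b) (S.lam (S.rho b a) c) := by
  rw [← S.mul_lam (S.lam a b), ← lam_circ, lam_circ_rho, lam_circ, ← lam_mul, mul_lam]

theorem rho_circ (S : SkewLeftBrace B) (b c a : B) :
    S.rho (S.circ b c) a = S.rho c (S.rho b a) := by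
  apply S.circ_left_cancel (a := S.lam a (S.circ b c))
  rw [lam_circ_rho, lam_circ_right, S.circ_assoc, lam_circ_rho, ← S.circ_assoc,
    ← S.circ_assoc, lam_circ_rho]

/-- A map whose kernel is a congruence for `∘` is invariant under all `lam x` and `rho x` if and
only if it identifies `a · b`, `b · a` and `a ∘ b`. -/
theorem invariant_iff_mul_eq {X : Type*} (S : SkewLeftBrace B) (f : B → X)
    (hl : ∀ a b c, f b = f c → f (S.circ a b) = f (S.circ a c))
    (hr : ∀ a b c, f b = f c → f (S.circ b a) = f (S.circ c a)) :
    ((∀ x y, f (S.lam x y) = f y) ∧ (∀ x y, f (S.rho x y) = f y)) ↔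
      ∀ a b, f (S.mul a b) = f (S.mul b a) ∧ f (S.mul a b) = f (S.circ a b) := by
  have cancel : ∀ a b c, f (S.circ a b) = f (S.circ a c) → f b = f c := fun a b c h => by
    simpa only [← S.circ_assoc, S.oinv_circ, S.one_circ] using hl (S.oinv a) _ _ h
  constructor
  · rintro ⟨h_lam, h_rho⟩
    have hmul : ∀ a b, f (S.mul a b) = f (S.circ a b) := fun a b => by
      rw [← circ_lam_oinv]
      exact hl _ _ _ (h_lam _ _)
    have hcomm : ∀ a b, f (S.circ a b) = f (S.circ b a) := fun a b => by
      rw [← S.lam_circ_rho a b]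
      exact (hr _ _ _ (h_lam a b)).trans (hl _ _ _ (h_rho b a))
    exact fun a b => ⟨by rw [hmul, hmul, hcomm], hmul a b⟩
  · intro h
    have hcomm : ∀ a b, f (S.circ a b) = f (S.circ b a) := fun a b => by
      rw [← (h a b).2, ← (h b a).2, (h a b).1]
    have h_lam : ∀ x y, f (S.lam x y) = f y := fun x y =>
      cancel x _ _ (by rw [← (h x (S.lam x y)).2, mul_lam])
    refine ⟨h_lam, fun x y => cancel x _ _ ?_⟩
    rw [← hr _ _ _ (h_lam y x), lam_circ_rho, hcomm]

/-- the associated solution of a skew left brace is 2-reductive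
iff `λ_{a·b} = λ_{b·a} = λ_{a∘b}` and `ρ_{a·b} = ρ_{b·a} = ρ_{a∘b}` for all
`a, b`. -/
theorem twoReductive_iff_lam_rho_eq (S : SkewLeftBrace B) :
    ((∀ x y, S.lam (S.lam x y) = S.lam y) ∧
     (∀ x y, S.rho (S.rho x y) = S.rho y) ∧
     (∀ x y, S.lam (S.rho x y) = S.lam y) ∧
     (∀ x y, S.rho (S.lam x y) = S.rho y)) ↔
    (∀ a b, S.lam (S.mul a b) = S.lam (S.mul b a) ∧
            S.lam (S.mul a b) = S.lam (S.circ a b) ∧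
            S.rho (S.mul a b) = S.rho (S.mul b a) ∧
            S.rho (S.mul a b) = S.rho (S.circ a b)) := by
  have h_lam := S.invariant_iff_mul_eq S.lam
    (fun a b c h => funext fun x => by rw [lam_circ, lam_circ, h])
    (fun a b c h => funext fun x => by rw [lam_circ, lam_circ, h])
  have h_rho := S.invariant_iff_mul_eq S.rho
    (fun a b c h => funext fun x => by rw [rho_circ, rho_circ, h])
    (fun a b c h => funext fun x => by rw [rho_circ, rho_circ, h])
  constructor
  · rintro ⟨hll, hrr, hlr, hrl⟩ a b
    obtain ⟨h₁, h₂⟩ := h_lam.1 ⟨hll, hlr⟩ a b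
    obtain ⟨h₃, h₄⟩ := h_rho.1 ⟨hrl, hrr⟩ a b
    exact ⟨h₁, h₂, h₃, h₄⟩
  · intro h
    obtain ⟨hll, hlr⟩ := h_lam.2 fun a b => ⟨(h a b).1, (h a b).2.1⟩
    obtain ⟨hrl, hrr⟩ := h_rho.2 fun a b => (h a b).2.2
    exact ⟨hll, hrr, hlr, hrl⟩
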